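/- Let (X, 𝒜, μ, T) be an ergodic probability-preserving dynamical system and (A_l) a sequence of measurable sets with μ(A_l) → 0. Then the normalized return-time process μ(A_l)·Φ_{A_l} converges in distribution under μ (hitting-time law) to an i.i.d. standard exponential process if and only if it converges in distribution under the conditional measures μ_{A_l} (return-time law) to an i.i.d. standard exponential process. -/

import Mathlib

open MeasureTheory Filter Topology
open scoped ENNReal

/-- Successive (absolute) return times to `A`: `retTime T A 0 x = 0` and
`retTime T A (i+1) x` is the least `m ≥ 1` with `m > retTime T A i x` and `T^[m] x ∈ A`
(`⊤` if none exists).  The gaps `retTime T A (i+1) x - retTime T A i x` form the process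
`Φ_A = (φ_A, φ_A∘T_A, φ_A∘T_A², …)`. -/
noncomputable def retTime {X : Type*} (T : X → X) (A : Set X) : ℕ → X → ℕ∞
  | 0, _ => 0
  | i + 1, x => sInf {j : ℕ∞ | ∃ m : ℕ, j = (m : ℕ∞) ∧ 1 ≤ m ∧
      retTime T A i x < (m : ℕ∞) ∧ T^[m] x ∈ A}

/-- Canonical embedding `ℕ∞ → [0,∞]`. -/
noncomputable def toE : ℕ∞ → ℝ≥0∞ := fun m => WithTop.map (Nat.cast : ℕ → NNReal) m

/-- The first `J` coordinates of the normalized return-time process `c·Φ_A`. -/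
noncomputable def retProc {X : Type*} (T : X → X) (A : Set X) (c : ℝ≥0∞) (J : ℕ) (x : X) :
    Fin J → ℝ≥0∞ :=
  fun i => c * toE (retTime T A ((i : ℕ) + 1) x - retTime T A (i : ℕ) x)

/-- The standard exponential law, pushed to `[0,∞]`. -/
noncomputable def expLaw : Measure ℝ≥0∞ :=
  (MeasureTheory.volume.withDensity fun x : ℝ =>
    ENNReal.ofReal (if 0 ≤ x then Real.exp (-x) else 0)).map ENNReal.ofReal

section ReturnTimes

variable {X : Type*}

theorem retTime_succ_lt_iff (T : X → X) (A : Set X) (i : ℕ) (x : X) (n : ℕ∞) :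
    retTime T A (i + 1) x < n ↔
      ∃ m : ℕ, (m : ℕ∞) < n ∧ 1 ≤ m ∧ retTime T A i x < (m : ℕ∞) ∧ T^[m] x ∈ A := by
  rw [retTime, sInf_lt_iff]
  constructor
  · rintro ⟨_, ⟨m, rfl, h⟩, hn⟩
    exact ⟨m, hn, h⟩
  · rintro ⟨m, hn, h⟩
    exact ⟨m, ⟨m, rfl, h⟩, hn⟩

theorem le_retTime_succ_iff (T : X → X) (A : Set X) (i : ℕ) (x : X) (n : ℕ∞) :
    n ≤ retTime T A (i + 1) x ↔
      ∀ m : ℕ, 1 ≤ m → retTime T A i x < (m : ℕ∞) → T^[m] x ∈ A → n ≤ (m : ℕ∞) := by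
  rw [← not_iff_not, not_le, retTime_succ_lt_iff]
  push Not
  constructor
  · rintro ⟨m, h1, h2, h3, h4⟩
    exact ⟨m, h2, h3, h4, h1⟩
  · rintro ⟨m, h2, h3, h4, h1⟩
    exact ⟨m, h1, h2, h3, h4⟩

theorem retTime_succ_eq_add_one {T : X → X} {A : Set X} {i k : ℕ} {x : X}
    (h : ∀ m : ℕ, retTime T A i x < ((m + 1 : ℕ) : ℕ∞) ∧ T^[m] (T x) ∈ A ↔
      1 ≤ m ∧ retTime T A k (T x) < (m : ℕ∞) ∧ T^[m] (T x) ∈ A) :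
    retTime T A (i + 1) x = retTime T A (k + 1) (T x) + 1 := by
  apply le_antisymm
  · rcases eq_or_ne (retTime T A (k + 1) (T x)) ⊤ with htop | htop
    · simp [htop]
    obtain ⟨m, hm, h1, h2, h3⟩ := (retTime_succ_lt_iff T A k (T x) _).1
      ((ENat.lt_add_one_iff htop).2 le_rfl)
    obtain ⟨h4, h5⟩ := (h m).2 ⟨h1, h2, h3⟩
    have := (le_retTime_succ_iff T A i x _).1 le_rfl (m + 1) (Nat.le_add_left 1 m) h4 h5
    refine this.trans ?_
    rw [Nat.cast_add, Nat.cast_one]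
    gcongr
    exact (ENat.lt_add_one_iff htop).1 hm
  · rw [le_retTime_succ_iff]
    intro m hm h1 h2
    obtain ⟨m, rfl⟩ := Nat.exists_eq_add_of_le' hm
    obtain ⟨h3, h4, h5⟩ := (h m).1 ⟨h1, h2⟩
    rw [Nat.cast_add, Nat.cast_one]
    gcongr
    exact (le_retTime_succ_iff T A k (T x) _).1 le_rfl m h3 h4 h5

theorem retTime_succ_of_notMem {T : X → X} {A : Set X} {x : X} (hx : T x ∉ A) (i : ℕ) :
    retTime T A (i + 1) x = retTime T A (i + 1) (T x) + 1 := by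
  induction i with
  | zero =>
    refine retTime_succ_eq_add_one fun m => ?_
    rcases Nat.eq_zero_or_pos m with rfl | hm
    · simp [hx]
    · simp [retTime, hm, Nat.one_le_iff_ne_zero, hm.ne']
  | succ i ih =>
    refine retTime_succ_eq_add_one fun m => ?_
    rw [ih, Nat.cast_add, Nat.cast_one, ENat.add_lt_add_iff_right ENat.one_ne_top]
    refine ⟨fun h => ⟨?_, h⟩, fun h => h.2⟩
    exact_mod_cast Order.one_le_iff_ne_zero.2 (bot_le.trans_lt h.1).ne'

theorem retTime_succ_of_mem {T : X → X} {A : Set X} {x : X} (hx : T x ∈ A) (i : ℕ) :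
    retTime T A (i + 1) x = retTime T A i (T x) + 1 := by
  induction i with
  | zero =>
    apply le_antisymm
    · simpa [retTime] using (le_retTime_succ_iff T A 0 x _).1 le_rfl 1 le_rfl (by simp [retTime])
        (by simpa using hx)
    · rw [le_retTime_succ_iff]
      intro m hm _ _
      simpa [retTime] using hm
  | succ i ih =>
    refine retTime_succ_eq_add_one fun m => ?_
    rw [ih, Nat.cast_add, Nat.cast_one, ENat.add_lt_add_iff_right ENat.one_ne_top]
    refine ⟨fun h => ⟨?_, h⟩, fun h => h.2⟩
    exact_mod_cast Order.one_le_iff_ne_zero.2 (bot_le.trans_lt h.1).ne'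

theorem toE_add_one (m : ℕ∞) : toE (m + 1) = 1 + toE m := by
  rw [add_comm]
  cases m with
  | top => exact (add_top (1 : ℝ≥0∞)).symm
  | coe m =>
    change (((1 + m : ℕ) : NNReal) : ℝ≥0∞) = 1 + ((m : NNReal) : ℝ≥0∞)
    push_cast
    rfl

theorem toE_zero : toE 0 = 0 := by
  change (((0 : ℕ) : NNReal) : ℝ≥0∞) = 0
  simp

theorem enat_add_one_sub_add_one (m n : ℕ∞) : (m + 1) - (n + 1) = m - n := by
  cases m <;> cases n <;> first | rfl | (norm_cast; simp)

theorem retProc_zero (T : X → X) (A : Set X) (c : ℝ≥0∞) (J : ℕ) (x : X) :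
    retProc T A c (J + 1) x 0 = c * toE (retTime T A 1 x) := by
  simp [retProc, retTime]

theorem retProc_zero_of_mem {T : X → X} {A : Set X} {x : X} (hx : T x ∈ A) (c : ℝ≥0∞) (J : ℕ) :
    retProc T A c (J + 1) x 0 = c := by
  rw [retProc_zero, retTime_succ_of_mem hx, toE_add_one, retTime, toE_zero, add_zero, mul_one]

theorem retProc_zero_of_notMem {T : X → X} {A : Set X} {x : X} (hx : T x ∉ A) (c : ℝ≥0∞)
    (J : ℕ) : retProc T A c (J + 1) x 0 = c + retProc T A c (J + 1) (T x) 0 := by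
  rw [retProc_zero, retProc_zero, retTime_succ_of_notMem hx, toE_add_one, mul_add, mul_one]

theorem retProc_succ_of_mem {T : X → X} {A : Set X} {x : X} (hx : T x ∈ A) (c : ℝ≥0∞) (J : ℕ)
    (i : Fin J) : retProc T A c (J + 1) x i.succ = retProc T A c J (T x) i := by
  simp only [retProc, Fin.val_succ]
  rw [retTime_succ_of_mem hx, retTime_succ_of_mem hx, enat_add_one_sub_add_one]

theorem retProc_succ_of_notMem {T : X → X} {A : Set X} {x : X} (hx : T x ∉ A) (c : ℝ≥0∞)
    (J : ℕ) (i : Fin J) :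
    retProc T A c (J + 1) x i.succ = retProc T A c (J + 1) (T x) i.succ := by
  simp only [retProc, Fin.val_succ]
  rw [retTime_succ_of_notMem hx, retTime_succ_of_notMem hx, enat_add_one_sub_add_one]

theorem measurable_retTime [MeasurableSpace X] {T : X → X} {A : Set X} (hT : Measurable T)
    (hA : MeasurableSet A) (i : ℕ) : Measurable (retTime T A i) := by
  induction i with
  | zero => exact measurable_const
  | succ i ih =>
    have hlt (n : ℕ∞) : MeasurableSet {x | retTime T A (i + 1) x < n} := by
      simp only [retTime_succ_lt_iff]
      refine measurableSet_setOfPred.2 (Measurable.exists fun m =>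
        measurable_const.and (measurable_const.and (.and ?_ ?_)))
      · exact measurableSet_setOfPred.1 (ih (MeasurableSet.of_discrete (s := Set.Iio (m : ℕ∞))))
      · exact measurableSet_setOfPred.1 (hT.iterate m hA)
    refine ENat.measurable_iff.2 fun n => ?_
    convert (hlt (n + 1)).diff (hlt n) using 1
    ext x
    simp only [Set.mem_preimage, Set.mem_singleton_iff, Set.mem_sdiff, Set.mem_ofPred_eq, not_lt,
      ENat.lt_natCast_add_one_iff]
    exact le_antisymm_iff

theorem measurable_retProc [MeasurableSpace X] {T : X → X} {A : Set X} (hT : Measurable T)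
    (hA : MeasurableSet A) (c : ℝ≥0∞) (J : ℕ) : Measurable (retProc T A c J) := by
  refine measurable_pi_iff.2 fun i => ?_
  exact (Measurable.of_discrete (f := fun p : ℕ∞ × ℕ∞ => c * toE (p.1 - p.2))).comp
    ((measurable_retTime hT hA (i + 1)).prodMk (measurable_retTime hT hA i))

end ReturnTimes

section Laplace

/-- The function `t ↦ exp (-t)` on `[0,∞]`. -/
noncomputable def expNeg (t : ℝ≥0∞) : ℝ := (EReal.exp (-(t : EReal))).toReal

theorem exp_neg_le_one (t : ℝ≥0∞) : EReal.exp (-(t : EReal)) ≤ 1 := by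
  simpa using EReal.coe_ennreal_nonneg t

theorem expNeg_nonneg (t : ℝ≥0∞) : 0 ≤ expNeg t := ENNReal.toReal_nonneg

theorem expNeg_le_one (t : ℝ≥0∞) : expNeg t ≤ 1 :=
  ENNReal.toReal_mono ENNReal.one_ne_top (exp_neg_le_one t)

theorem expNeg_injective : Function.Injective expNeg := by
  intro s t h
  have h' := (ENNReal.toReal_eq_toReal_iff'
    ((exp_neg_le_one s).trans_lt ENNReal.one_lt_top).ne
    ((exp_neg_le_one t).trans_lt ENNReal.one_lt_top).ne).1 h
  simpa using EReal.exp_strictMono.injective h'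

theorem expNeg_add (s t : ℝ≥0∞) : expNeg (s + t) = expNeg s * expNeg t := by
  rw [expNeg, expNeg, expNeg, ← ENNReal.toReal_mul, ← EReal.exp_add, EReal.coe_ennreal_add,
    EReal.neg_add (.inl (EReal.coe_ennreal_ne_bot _)) (.inr (EReal.coe_ennreal_ne_bot _)),
    sub_eq_add_neg]

theorem expNeg_ofReal {r : ℝ} (hr : 0 ≤ r) : expNeg (ENNReal.ofReal r) = Real.exp (-r) := by
  rw [expNeg, EReal.coe_ennreal_ofReal, max_eq_left hr, ← EReal.coe_neg, EReal.exp_coe,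
    ENNReal.toReal_ofReal (Real.exp_pos _).le]

theorem continuous_expNeg : Continuous expNeg :=
  ENNReal.continuousOn_toReal.comp_continuous
    (ENNReal.continuous_exp.comp (continuous_neg.comp continuous_coe_ennreal_ereal))
    fun t => ((exp_neg_le_one t).trans_lt ENNReal.one_lt_top).ne

/-- The integrand of the Laplace transform at `s` on `[0,∞]^J`. -/
noncomputable def laplaceKernel {J : ℕ} (s : Fin J → ℝ) (ω : Fin J → ℝ≥0∞) : ℝ :=
  ∏ i, expNeg (ω i) ^ s i

theorem continuous_laplaceKernel {J : ℕ} {s : Fin J → ℝ} (hs : ∀ i, 0 ≤ s i) :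
    Continuous (laplaceKernel s) :=
  continuous_finsetProd _ fun i _ =>
    (continuous_expNeg.comp (continuous_apply i)).rpow_const fun _ => .inr (hs i)

theorem laplaceKernel_nonneg {J : ℕ} (s : Fin J → ℝ) (ω : Fin J → ℝ≥0∞) :
    0 ≤ laplaceKernel s ω :=
  Finset.prod_nonneg fun _ _ => Real.rpow_nonneg (expNeg_nonneg _) _

theorem laplaceKernel_le_one {J : ℕ} {s : Fin J → ℝ} (hs : ∀ i, 0 ≤ s i)
    (ω : Fin J → ℝ≥0∞) : laplaceKernel s ω ≤ 1 :=
  Finset.prod_le_one (fun _ _ => Real.rpow_nonneg (expNeg_nonneg _) _)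
    fun i _ => Real.rpow_le_one (expNeg_nonneg _) (expNeg_le_one _) (hs i)

theorem lintegral_expDensity :
    ∫⁻ x : ℝ, ENNReal.ofReal (if 0 ≤ x then Real.exp (-x) else 0) = 1 := by
  have h := ProbabilityTheory.lintegral_exponentialPDF_eq_one one_pos
  simpa [ProbabilityTheory.exponentialPDF_eq] using h

instance isProbabilityMeasure_expLaw : IsProbabilityMeasure expLaw := by
  have : IsProbabilityMeasure (volume.withDensity fun x : ℝ =>
      ENNReal.ofReal (if 0 ≤ x then Real.exp (-x) else 0)) :=
    ⟨by rw [withDensity_apply _ MeasurableSet.univ, Measure.restrict_univ, lintegral_expDensity]⟩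
  exact Measure.isProbabilityMeasure_map ENNReal.measurable_ofReal.aemeasurable

theorem integral_expNeg_rpow_expLaw {s : ℝ} (hs : 0 ≤ s) :
    ∫ t, expNeg t ^ s ∂expLaw = (1 + s)⁻¹ := by
  have hm : Measurable fun x : ℝ => ENNReal.ofReal (if 0 ≤ x then Real.exp (-x) else 0) :=
    (Measurable.ite measurableSet_Ici (by fun_prop) measurable_const).ennreal_ofReal
  have hc : Continuous fun t => expNeg t ^ s := continuous_expNeg.rpow_const fun _ => .inr hs
  rw [expLaw, integral_map ENNReal.measurable_ofReal.aemeasurable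
      hc.measurable.aestronglyMeasurable,
    integral_withDensity_eq_integral_toReal_smul hm (by simp)]
  have : (fun x : ℝ => (ENNReal.ofReal (if 0 ≤ x then Real.exp (-x) else 0)).toReal •
      expNeg (ENNReal.ofReal x) ^ s) =
      (Set.Ici 0).indicator fun x => Real.exp (-(1 + s) * x) := by
    ext x
    by_cases hx : 0 ≤ x
    · rw [Set.indicator_of_mem (Set.mem_Ici.2 hx), if_pos hx, expNeg_ofReal hx,
        ENNReal.toReal_ofReal (Real.exp_pos _).le, ← Real.exp_mul, smul_eq_mul, ← Real.exp_add]
      congr 1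
      ring
    · simp [hx]
  rw [this, integral_indicator measurableSet_Ici, integral_Ici_eq_integral_Ioi,
    integral_exp_mul_Ioi (by linarith)]
  rw [mul_zero, Real.exp_zero, neg_div_neg_eq, one_div]

theorem integral_laplaceKernel_pi_expLaw {J : ℕ} {s : Fin J → ℝ} (hs : ∀ i, 0 ≤ s i) :
    ∫ ω, laplaceKernel s ω ∂(Measure.pi fun _ : Fin J => expLaw) = ∏ i, (1 + s i)⁻¹ := by
  simp only [laplaceKernel]
  rw [integral_fintype_prod_eq_prod (f := fun i t => expNeg t ^ s i)]
  exact Finset.prod_congr rfl fun i _ => integral_expNeg_rpow_expLaw (hs i)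

end Laplace

section Duality

variable {X : Type*}

theorem laplaceKernel_succ {J : ℕ} (s : Fin (J + 1) → ℝ) (ω : Fin (J + 1) → ℝ≥0∞) :
    laplaceKernel s ω = expNeg (ω 0) ^ s 0 * laplaceKernel (Fin.tail s) (Fin.tail ω) :=
  Fin.prod_univ_succ _

theorem laplaceKernel_retProc_of_mem {T : X → X} {A : Set X} {x : X} (hx : T x ∈ A) (c : ℝ≥0∞)
    {J : ℕ} (s : Fin (J + 1) → ℝ) :
    laplaceKernel s (retProc T A c (J + 1) x) =
      expNeg c ^ s 0 * laplaceKernel (Fin.tail s) (retProc T A c J (T x)) := by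
  rw [laplaceKernel_succ, retProc_zero_of_mem hx]
  congr 2
  exact funext fun i => retProc_succ_of_mem hx c J i

theorem laplaceKernel_retProc_of_notMem {T : X → X} {A : Set X} {x : X} (hx : T x ∉ A)
    (c : ℝ≥0∞) {J : ℕ} (s : Fin (J + 1) → ℝ) :
    laplaceKernel s (retProc T A c (J + 1) x) =
      expNeg c ^ s 0 * laplaceKernel s (retProc T A c (J + 1) (T x)) := by
  rw [laplaceKernel_succ, laplaceKernel_succ, retProc_zero_of_notMem hx, expNeg_add,
    Real.mul_rpow (expNeg_nonneg _) (expNeg_nonneg _), mul_assoc]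
  congr 3
  exact funext fun i => retProc_succ_of_notMem hx c J i

theorem measurable_laplaceKernel_retProc [MeasurableSpace X] {T : X → X} {A : Set X}
    (hT : Measurable T) (hA : MeasurableSet A) (c : ℝ≥0∞) {J : ℕ} {s : Fin J → ℝ}
    (hs : ∀ i, 0 ≤ s i) : Measurable fun x => laplaceKernel s (retProc T A c J x) :=
  (continuous_laplaceKernel hs).measurable.comp (measurable_retProc hT hA c J)

theorem integrable_laplaceKernel_retProc [MeasurableSpace X] {μ : Measure X} [IsFiniteMeasure μ]
    {T : X → X} {A : Set X} (hT : Measurable T) (hA : MeasurableSet A) (c : ℝ≥0∞) {J : ℕ}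
    {s : Fin J → ℝ} (hs : ∀ i, 0 ≤ s i) :
    Integrable (fun x => laplaceKernel s (retProc T A c J x)) μ := by
  refine .of_bound (measurable_laplaceKernel_retProc hT hA c hs).aestronglyMeasurable 1
    (.of_forall fun x => ?_)
  rw [Real.norm_of_nonneg (laplaceKernel_nonneg _ _)]
  exact laplaceKernel_le_one hs _

theorem integral_laplaceKernel_retProc [MeasurableSpace X] {μ : Measure X} [IsFiniteMeasure μ]
    {T : X → X} (hT : MeasurePreserving T μ μ) {A : Set X} (hA : MeasurableSet A) (c : ℝ≥0∞)
    {J : ℕ} {s : Fin (J + 1) → ℝ} (hs : ∀ i, 0 ≤ s i) :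
    ∫ x, laplaceKernel s (retProc T A c (J + 1) x) ∂μ = expNeg c ^ s 0 *
      (∫ x in A, laplaceKernel (Fin.tail s) (retProc T A c J x) ∂μ +
        (∫ x, laplaceKernel s (retProc T A c (J + 1) x) ∂μ -
          ∫ x in A, laplaceKernel s (retProc T A c (J + 1) x) ∂μ)) := by
  classical
  set H := fun x => laplaceKernel s (retProc T A c (J + 1) x) with hH
  set G := fun x => laplaceKernel (Fin.tail s) (retProc T A c J x) with hG
  have hHi : Integrable H μ := integrable_laplaceKernel_retProc hT.measurable hA c hs
  have hGi : Integrable G μ :=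
    integrable_laplaceKernel_retProc hT.measurable hA c fun i => hs i.succ
  have hstep : H = fun x => expNeg c ^ s 0 * A.piecewise G H (T x) := by
    ext x
    by_cases hx : T x ∈ A
    · rw [Set.piecewise_eq_of_mem _ _ _ hx]
      exact laplaceKernel_retProc_of_mem hx c s
    · rw [Set.piecewise_eq_of_notMem _ _ _ hx]
      exact laplaceKernel_retProc_of_notMem hx c s
  have hpi : Integrable (A.piecewise G H) μ :=
    Integrable.piecewise hA hGi.integrableOn hHi.integrableOn
  calc ∫ x, H x ∂μ = ∫ x, expNeg c ^ s 0 * A.piecewise G H (T x) ∂μ := by rw [← hstep]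
    _ = expNeg c ^ s 0 * ∫ x, A.piecewise G H x ∂μ := by
      rw [integral_const_mul, ← integral_map hT.aemeasurable
        (by rw [hT.map_eq]; exact hpi.aestronglyMeasurable), hT.map_eq]
    _ = _ := by
      rw [integral_piecewise hA hGi.integrableOn hHi.integrableOn, setIntegral_compl hA hHi]

/-- Duality between the Laplace transforms of the return and hitting time laws. -/
theorem laplace_return_eq [MeasurableSpace X] {μ : Measure X} [IsProbabilityMeasure μ]
    {T : X → X} (hT : MeasurePreserving T μ μ) {A : Set X} (hA : MeasurableSet A)
    {J : ℕ} {s : Fin (J + 1) → ℝ} (hs : ∀ i, 0 ≤ s i) :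
    ∫ x, laplaceKernel s (retProc T A (μ A) (J + 1) x) ∂((μ A)⁻¹ • μ.restrict A) =
      ∫ x, laplaceKernel (Fin.tail s) (retProc T A (μ A) J x) ∂((μ A)⁻¹ • μ.restrict A) -
        (Real.exp (s 0 * μ.real A) - 1) / μ.real A *
          ∫ x, laplaceKernel s (retProc T A (μ A) (J + 1) x) ∂μ := by
  have h := integral_laplaceKernel_retProc hT hA (μ A) hs
  have hw : expNeg (μ A) ^ s 0 = (Real.exp (s 0 * μ.real A))⁻¹ := by
    rw [← ofReal_measureReal, expNeg_ofReal measureReal_nonneg, ← Real.exp_mul, ← Real.exp_neg]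
    congr 1
    ring
  rw [hw, eq_inv_mul_iff_mul_eq₀ (Real.exp_ne_zero _)] at h
  simp only [integral_smul_measure, ENNReal.toReal_inv, smul_eq_mul, ← measureReal_def]
  rw [div_mul_eq_mul_div, sub_mul, h]
  ring

end Duality

section Convergence

theorem tendsto_exp_mul_sub_one_div {c : ℕ → ℝ} (hc : Tendsto c atTop (𝓝 0))
    (hc0 : ∀ l, c l ≠ 0) (s : ℝ) :
    Tendsto (fun l => (Real.exp (s * c l) - 1) / c l) atTop (𝓝 s) := by
  have h : HasDerivAt (fun t => Real.exp (s * t)) s 0 := by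
    simpa using ((hasDerivAt_id (0 : ℝ)).const_mul s).exp
  have h2 := h.tendsto_slope.comp
    (tendsto_nhdsWithin_of_tendsto_nhds_of_eventually_within _ hc (.of_forall hc0))
  refine h2.congr fun l => ?_
  simp [slope_def_field]

/-- Convergence of the Laplace transforms at natural points implies convergence in distribution
of random vectors in `[0,∞]^J`. -/
theorem tendsto_integral_of_tendsto_laplace {X : Type*} [MeasurableSpace X]
    {P : ℕ → Measure X} [∀ l, IsProbabilityMeasure (P l)] {J : ℕ}
    {Z : ℕ → X → Fin J → ℝ≥0∞} (hZ : ∀ l, Measurable (Z l))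
    {π : Measure (Fin J → ℝ≥0∞)} [IsProbabilityMeasure π]
    (h : ∀ s : Fin J → ℝ, (∀ i, 0 ≤ s i) →
      Tendsto (fun l => ∫ x, laplaceKernel s (Z l x) ∂P l) atTop
        (𝓝 (∫ ω, laplaceKernel s ω ∂π)))
    (g : BoundedContinuousFunction (Fin J → ℝ≥0∞) ℝ) :
    Tendsto (fun l => ∫ x, g (Z l x) ∂P l) atTop (𝓝 (∫ ω, g ω ∂π)) := by
  have hint (f : C(Fin J → ℝ≥0∞, ℝ)) (l : ℕ) : Integrable (fun x => f (Z l x)) (P l) :=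
    .of_bound (f.continuous.measurable.comp (hZ l)).aestronglyMeasurable ‖f‖
      (.of_forall fun x => f.norm_coe_le_norm _)
  have hint' (f : C(Fin J → ℝ≥0∞, ℝ)) : Integrable f π :=
    .of_bound f.continuous.measurable.aestronglyMeasurable ‖f‖
      (.of_forall fun x => f.norm_coe_le_norm _)
  let e (i : Fin J) : C(Fin J → ℝ≥0∞, ℝ) :=
    ⟨fun ω => expNeg (ω i), continuous_expNeg.comp (continuous_apply i)⟩
  let S : Subalgebra ℝ C(Fin J → ℝ≥0∞, ℝ) := Algebra.adjoin ℝ (Set.range e)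
  have hmon (f : C(Fin J → ℝ≥0∞, ℝ)) (hf : f ∈ Submonoid.closure (Set.range e)) :
      ∃ s : Fin J → ℝ, (∀ i, 0 ≤ s i) ∧ ∀ ω, f ω = laplaceKernel s ω := by
    induction hf using Submonoid.closure_induction with
    | mem f hf =>
      obtain ⟨i, rfl⟩ := hf
      refine ⟨Pi.single i 1, fun j => ?_, fun ω => ?_⟩
      · by_cases hj : j = i <;> simp [hj]
      · rw [laplaceKernel, Finset.prod_eq_single i]
        · simp [e]
        · intro j _ hj
          simp [hj]
        · simp
    | one => exact ⟨0, fun _ => le_rfl, fun ω => by simp [laplaceKernel]⟩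
    | mul f₁ f₂ _ _ h₁ h₂ =>
      obtain ⟨s₁, hs₁, h₁⟩ := h₁
      obtain ⟨s₂, hs₂, h₂⟩ := h₂
      refine ⟨s₁ + s₂, fun i => add_nonneg (hs₁ i) (hs₂ i), fun ω => ?_⟩
      rw [ContinuousMap.mul_apply, h₁, h₂, laplaceKernel, laplaceKernel, laplaceKernel,
        ← Finset.prod_mul_distrib]
      exact Finset.prod_congr rfl fun i _ =>
        (Real.rpow_add_of_nonneg (expNeg_nonneg _) (hs₁ i) (hs₂ i)).symm
  have hS (f : C(Fin J → ℝ≥0∞, ℝ)) (hf : f ∈ S) :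
      Tendsto (fun l => ∫ x, f (Z l x) ∂P l) atTop (𝓝 (∫ ω, f ω ∂π)) := by
    have hf' : f ∈ Submodule.span ℝ (Submonoid.closure (Set.range e) : Set _) := by
      rw [← Algebra.adjoin_eq_span]
      exact hf
    clear hf
    induction hf' using Submodule.span_induction with
    | mem f hf =>
      obtain ⟨s, hs, hfs⟩ := hmon f hf
      simpa only [hfs] using h s hs
    | zero => simp
    | add f₁ f₂ _ _ h₁ h₂ =>
      simp only [ContinuousMap.add_apply]
      rw [integral_add (hint' f₁) (hint' f₂)]
      simpa only [integral_add (hint f₁ _) (hint f₂ _)] using h₁.add h₂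
    | smul r f _ hf =>
      simp only [ContinuousMap.smul_apply, integral_smul]
      exact hf.const_smul r
  have htop : S.topologicalClosure = ⊤ := by
    refine ContinuousMap.subalgebra_topologicalClosure_eq_top_of_separatesPoints S ?_
    intro x y hxy
    obtain ⟨i, hi⟩ := Function.ne_iff.1 hxy
    exact ⟨_, ⟨e i, Algebra.subset_adjoin ⟨i, rfl⟩, rfl⟩, fun h' => hi (expNeg_injective h')⟩
  let g' : C(Fin J → ℝ≥0∞, ℝ) := g.toContinuousMap
  have hg' : g' ∈ closure (S : Set C(Fin J → ℝ≥0∞, ℝ)) := by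
    rw [← Subalgebra.topologicalClosure_coe, htop]
    trivial
  refine Metric.tendsto_atTop.2 fun ε hε => ?_
  obtain ⟨f, hfS, hfg⟩ := Metric.mem_closure_iff.1 hg' (ε / 3) (by positivity)
  have hb (ω) : ‖g' ω - f ω‖ ≤ ε / 3 := by
    rw [← dist_eq_norm]
    exact (ContinuousMap.dist_apply_le_dist ω).trans hfg.le
  obtain ⟨N, hN⟩ := Metric.tendsto_atTop.1 (hS f hfS) (ε / 3) (by positivity)
  refine ⟨N, fun l hl => ?_⟩
  have h1 : ‖∫ x, g' (Z l x) ∂P l - ∫ x, f (Z l x) ∂P l‖ ≤ ε / 3 := by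
    rw [← integral_sub (hint g' l) (hint f l)]
    simpa using norm_integral_le_of_norm_le_const (μ := P l) (.of_forall fun x => hb (Z l x))
  have h2 : ‖∫ ω, g' ω ∂π - ∫ ω, f ω ∂π‖ ≤ ε / 3 := by
    rw [← integral_sub (hint' g') (hint' f)]
    simpa using norm_integral_le_of_norm_le_const (μ := π) (.of_forall hb)
  have h3 := hN l hl
  rw [Real.dist_eq, abs_lt] at h3 ⊢
  rw [Real.norm_eq_abs, abs_le] at h1 h2
  change _ < ∫ x, g' (Z l x) ∂P l - ∫ ω, g' ω ∂π ∧ ∫ x, g' (Z l x) ∂P l - ∫ ω, g' ω ∂π < _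
  constructor <;> linarith [h1.1, h1.2, h2.1, h2.2, h3.1, h3.2]

/-- If the Laplace transforms of `[0,∞]^(J+1)`-valued random vectors converge whenever the zeroth
parameter is positive, and the limit of the zeroth marginal is exponential, then they also converge
when the zeroth parameter vanishes. -/
theorem tendsto_laplace_of_zero {X : Type*} [MeasurableSpace X] {μ : Measure X}
    [IsProbabilityMeasure μ] {J : ℕ} {Z : ℕ → X → Fin (J + 1) → ℝ≥0∞} (hZ : ∀ l, Measurable (Z l))
    (h : ∀ s : Fin (J + 1) → ℝ, (∀ i, 0 ≤ s i) → 0 < s 0 →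
      Tendsto (fun l => ∫ x, laplaceKernel s (Z l x) ∂μ) atTop (𝓝 (∏ i, (1 + s i)⁻¹)))
    {s : Fin (J + 1) → ℝ} (hs : ∀ i, 0 ≤ s i) :
    Tendsto (fun l => ∫ x, laplaceKernel s (Z l x) ∂μ) atTop (𝓝 (∏ i, (1 + s i)⁻¹)) := by
  rcases (hs 0).lt_or_eq with h0 | h0
  · exact h s hs h0
  have hint {t : Fin (J + 1) → ℝ} (ht : ∀ i, 0 ≤ t i) (l : ℕ) :
      Integrable (fun x => laplaceKernel t (Z l x)) μ := by
    refine .of_bound ((continuous_laplaceKernel ht).measurable.comp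
      (hZ l)).aestronglyMeasurable 1 (.of_forall fun x => ?_)
    rw [Real.norm_of_nonneg (laplaceKernel_nonneg _ _)]
    exact laplaceKernel_le_one ht _
  set p := ∏ i : Fin J, (1 + s i.succ)⁻¹ with hp
  have hp0 : 0 ≤ p := Finset.prod_nonneg fun i _ => inv_nonneg.2 (by linarith [hs i.succ])
  have hp1 : p ≤ 1 := Finset.prod_le_one (fun i _ => inv_nonneg.2 (by linarith [hs i.succ]))
    fun i _ => inv_le_one_of_one_le₀ (by linarith [hs i.succ])
  have hlim : ∏ i, (1 + s i)⁻¹ = p := by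
    rw [Fin.prod_univ_succ, ← h0]
    simp [hp]
  rw [hlim]
  refine Metric.tendsto_atTop.2 fun ε hε => ?_
  set δ := ε / 4 with hδ
  have hδ0 : 0 < δ := by positivity
  have hs₁ : ∀ i, 0 ≤ (Fin.cons δ (Fin.tail s) : Fin (J + 1) → ℝ) i :=
    Fin.cases hδ0.le fun i => hs i.succ
  have hs₂ : ∀ i, 0 ≤ (Fin.cons δ 0 : Fin (J + 1) → ℝ) i :=
    Fin.cases hδ0.le fun i => le_rfl
  have hL₁ := h (Fin.cons δ (Fin.tail s)) hs₁ hδ0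
  have hL₂ := h (Fin.cons δ 0) hs₂ hδ0
  simp only [Fin.prod_univ_succ, Fin.cons_zero, Fin.cons_succ, Fin.tail, Pi.zero_apply, add_zero,
    inv_one, Finset.prod_const_one, mul_one] at hL₁ hL₂
  rw [← hp] at hL₁
  have hq0 : 1 - δ ≤ (1 + δ)⁻¹ := by
    rw [← one_div, le_div_iff₀ (by positivity)]
    nlinarith
  have hq1 : (1 + δ)⁻¹ ≤ 1 := inv_le_one_of_one_le₀ (by linarith)
  obtain ⟨N₁, hN₁⟩ := Metric.tendsto_atTop.1 hL₁ δ hδ0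
  obtain ⟨N₂, hN₂⟩ := Metric.tendsto_atTop.1 hL₂ δ hδ0
  refine ⟨max N₁ N₂, fun l hl => ?_⟩
  have h₁ := hN₁ l (le_of_max_le_left hl)
  have h₂ := hN₂ l (le_of_max_le_right hl)
  have hsplit (x : X) : laplaceKernel (Fin.cons δ (Fin.tail s)) (Z l x) =
      laplaceKernel (Fin.cons δ 0) (Z l x) * laplaceKernel s (Z l x) := by
    simp [laplaceKernel, Fin.prod_univ_succ, ← h0, Fin.tail]
  have hle : ∫ x, laplaceKernel (Fin.cons δ (Fin.tail s)) (Z l x) ∂μ ≤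
      ∫ x, laplaceKernel s (Z l x) ∂μ := by
    refine integral_mono (hint hs₁ l) (hint hs l) fun x => ?_
    dsimp only
    rw [hsplit]
    exact mul_le_of_le_one_left (laplaceKernel_nonneg _ _) (laplaceKernel_le_one hs₂ _)
  have hge : ∫ x, laplaceKernel s (Z l x) ∂μ -
      ∫ x, laplaceKernel (Fin.cons δ (Fin.tail s)) (Z l x) ∂μ ≤
      1 - ∫ x, laplaceKernel (Fin.cons δ 0) (Z l x) ∂μ := by
    have h1 : ∫ x, (1 - laplaceKernel (Fin.cons δ 0) (Z l x)) ∂μ =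
        1 - ∫ x, laplaceKernel (Fin.cons δ 0) (Z l x) ∂μ := by
      rw [integral_sub (integrable_const _) (hint hs₂ l)]
      simp
    rw [← integral_sub (hint hs l) (hint hs₁ l), ← h1]
    refine integral_mono ((hint hs l).sub (hint hs₁ l))
      ((integrable_const _).sub (hint hs₂ l)) fun x => ?_
    dsimp only
    rw [hsplit]
    nlinarith [laplaceKernel_le_one hs (Z l x), laplaceKernel_le_one hs₂ (Z l x)]
  rw [Real.dist_eq, abs_lt] at h₁ h₂ ⊢
  constructor <;> nlinarith

end Convergence

section LaplaceDuality

variable {X : Type*} [MeasurableSpace X] {μ : Measure X} [IsProbabilityMeasure μ] {T : X → X}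
  {A : ℕ → Set X}

theorem isProbabilityMeasure_inv_smul_restrict {B : Set X} (hB : 0 < μ B) :
    IsProbabilityMeasure ((μ B)⁻¹ • μ.restrict B) :=
  ⟨by simpa using ENNReal.inv_mul_cancel hB.ne' (measure_ne_top μ B)⟩

theorem integral_laplaceKernel_zero {P : Measure X} [IsProbabilityMeasure P] (s : Fin 0 → ℝ)
    (Z : X → Fin 0 → ℝ≥0∞) : ∫ x, laplaceKernel s (Z x) ∂P = ∏ i, (1 + s i)⁻¹ := by
  simp [laplaceKernel]

theorem tendsto_laplace_return_of_hitting (hT : MeasurePreserving T μ μ)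
    (hA : ∀ l, MeasurableSet (A l)) (hApos : ∀ l, 0 < μ (A l))
    (hrare : Tendsto (fun l => μ.real (A l)) atTop (𝓝 0))
    (h : ∀ (J : ℕ) (s : Fin J → ℝ), (∀ i, 0 ≤ s i) →
      Tendsto (fun l => ∫ x, laplaceKernel s (retProc T (A l) (μ (A l)) J x) ∂μ) atTop
        (𝓝 (∏ i, (1 + s i)⁻¹)))
    (J : ℕ) (s : Fin J → ℝ) (hs : ∀ i, 0 ≤ s i) :
    Tendsto (fun l => ∫ x, laplaceKernel s (retProc T (A l) (μ (A l)) J x)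
      ∂((μ (A l))⁻¹ • μ.restrict (A l))) atTop (𝓝 (∏ i, (1 + s i)⁻¹)) := by
  have (l : ℕ) := isProbabilityMeasure_inv_smul_restrict (hApos l)
  induction J with
  | zero => simp only [integral_laplaceKernel_zero, tendsto_const_nhds]
  | succ J ih =>
    simp only [laplace_return_eq hT (hA _) hs]
    have hc := tendsto_exp_mul_sub_one_div hrare
      (fun l => (ENNReal.toReal_pos (hApos l).ne' (measure_ne_top μ _)).ne') (s 0)
    convert (ih (Fin.tail s) fun i => hs i.succ).sub (hc.mul (h (J + 1) s hs)) using 2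
    have h0 : 1 + s 0 ≠ 0 := by linarith [hs 0]
    rw [Fin.prod_univ_succ]
    simp only [Fin.tail]
    field_simp
    ring

theorem tendsto_laplace_hitting_of_return (hT : MeasurePreserving T μ μ)
    (hA : ∀ l, MeasurableSet (A l)) (hApos : ∀ l, 0 < μ (A l))
    (hrare : Tendsto (fun l => μ.real (A l)) atTop (𝓝 0))
    (h : ∀ (J : ℕ) (s : Fin J → ℝ), (∀ i, 0 ≤ s i) →
      Tendsto (fun l => ∫ x, laplaceKernel s (retProc T (A l) (μ (A l)) J x)
        ∂((μ (A l))⁻¹ • μ.restrict (A l))) atTop (𝓝 (∏ i, (1 + s i)⁻¹)))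
    (J : ℕ) (s : Fin J → ℝ) (hs : ∀ i, 0 ≤ s i) :
    Tendsto (fun l => ∫ x, laplaceKernel s (retProc T (A l) (μ (A l)) J x) ∂μ) atTop
      (𝓝 (∏ i, (1 + s i)⁻¹)) := by
  cases J with
  | zero => simp only [integral_laplaceKernel_zero, tendsto_const_nhds]
  | succ J =>
    refine tendsto_laplace_of_zero (fun l => measurable_retProc hT.measurable (hA l) _ _)
      (fun s hs h0 => ?_) hs
    have hc (l : ℕ) : 0 < μ.real (A l) := ENNReal.toReal_pos (hApos l).ne' (measure_ne_top μ _)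
    have hlim := (tendsto_exp_mul_sub_one_div hrare (fun l => (hc l).ne') (s 0)).inv₀ h0.ne'
    have hprod := hlim.mul ((h J (Fin.tail s) fun i => hs i.succ).sub (h (J + 1) s hs))
    convert hprod.congr fun l => ?_ using 2
    · have h1 : 1 + s 0 ≠ 0 := by linarith
      rw [Fin.prod_univ_succ]
      simp only [Fin.tail]
      field_simp
      ring
    · have hpos : 0 < (Real.exp (s 0 * μ.real (A l)) - 1) / μ.real (A l) :=
        div_pos (sub_pos.2 (Real.one_lt_exp_iff.2 (mul_pos h0 (hc l)))) (hc l)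
      rw [laplace_return_eq hT (hA l) hs, sub_sub_cancel, inv_mul_cancel_left₀ hpos.ne']

theorem tendsto_integral_iff_tendsto_laplace {P : ℕ → Measure X}
    [∀ l, IsProbabilityMeasure (P l)] {Z : ℕ → ∀ J : ℕ, X → Fin J → ℝ≥0∞}
    (hZ : ∀ l J, Measurable (Z l J)) :
    (∀ J : ℕ, ∀ g : BoundedContinuousFunction (Fin J → ℝ≥0∞) ℝ,
        Tendsto (fun l => ∫ x, g (Z l J x) ∂P l) atTop
          (𝓝 (∫ ω, g ω ∂(Measure.pi fun _ : Fin J => expLaw)))) ↔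
      ∀ (J : ℕ) (s : Fin J → ℝ), (∀ i, 0 ≤ s i) →
        Tendsto (fun l => ∫ x, laplaceKernel s (Z l J x) ∂P l) atTop
          (𝓝 (∏ i, (1 + s i)⁻¹)) := by
  refine ⟨fun h J s hs => ?_, fun h J => ?_⟩
  · rw [← integral_laplaceKernel_pi_expLaw hs]
    exact h J (BoundedContinuousFunction.mkOfCompact ⟨_, continuous_laplaceKernel hs⟩)
  · refine tendsto_integral_of_tendsto_laplace (fun l => hZ l J) fun s hs => ?_
    rw [integral_laplaceKernel_pi_expLaw hs]
    exact h J s hs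

end LaplaceDuality

/-- hitting/return time duality.  For an ergodic probability-preserving
system and rare events `A_l`, the normalized return-time processes `μ(A_l)·Φ_{A_l}`
converge in distribution (in the sense of all finite-dimensional distributions, tested
against bounded continuous functions) under `μ` to an i.i.d. standard exponential process
iff they converge under the conditional measures `μ_{A_l}` to the same limit. -/
theorem stmt_19 {X : Type*} [MeasurableSpace X] (μ : Measure X) [IsProbabilityMeasure μ]
    (T : X → X) (hT : MeasurePreserving T μ μ) (hErg : Ergodic T μ)
    (A : ℕ → Set X) (hA : ∀ l, MeasurableSet (A l)) (hApos : ∀ l, 0 < μ (A l))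
    (hrare : Tendsto (fun l => μ (A l)) atTop (𝓝 0)) :
    (∀ J : ℕ, ∀ g : BoundedContinuousFunction (Fin J → ℝ≥0∞) ℝ,
        Tendsto (fun l => ∫ x, g (retProc T (A l) (μ (A l)) J x) ∂μ) atTop
          (𝓝 (∫ ω, g ω ∂(Measure.pi fun _ : Fin J => expLaw))))
      ↔
    (∀ J : ℕ, ∀ g : BoundedContinuousFunction (Fin J → ℝ≥0∞) ℝ,
        Tendsto (fun l => ∫ x, g (retProc T (A l) (μ (A l)) J x)
            ∂((μ (A l))⁻¹ • μ.restrict (A l))) atTop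
          (𝓝 (∫ ω, g ω ∂(Measure.pi fun _ : Fin J => expLaw)))) := by
  have hrare' : Tendsto (fun l => μ.real (A l)) atTop (𝓝 0) :=
    (ENNReal.tendsto_toReal ENNReal.zero_ne_top).comp hrare
  have (l : ℕ) := isProbabilityMeasure_inv_smul_restrict (hApos l)
  have hZ (l J : ℕ) := measurable_retProc hT.measurable (hA l) (μ (A l)) J
  rw [tendsto_integral_iff_tendsto_laplace (P := fun _ => μ) hZ,
    tendsto_integral_iff_tendsto_laplace (P := fun l => (μ (A l))⁻¹ • μ.restrict (A l)) hZ]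
  exact ⟨tendsto_laplace_return_of_hitting hT hA hApos hrare',
    tendsto_laplace_hitting_of_return hT hA hApos hrare'⟩
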